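/- arXiv:0911.1135 — 8 statements merged into one kernel-verified Lean document; each statement's English description precedes it below -/
import Mathlib

section
/- Let R be a commutative ring and I a proper ideal of R. Then the amalgamated duplication R⋈I is a quasi-Frobenius ring if and only if R is quasi-Frobenius and I = Ra for some idempotent element a of R. -/
/-- The amalgamated duplication of a commutative ring `R` along an ideal `I`,
realized as the subring `{(x, y) ∈ R × R : y - x ∈ I}` of `R × R`. -/
def amalgDup (R : Type*) [CommRing R] (I : Ideal R) : Subring (R × R) where
  carrier := {p | p.2 - p.1 ∈ I}
  zero_mem' := by simp
  one_mem' := by simp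
  add_mem' := by
    intro a b ha hb
    have := I.add_mem ha hb
    simpa [add_sub_add_comm] using this
  neg_mem' := by
    intro a ha
    show -a.2 - -a.1 ∈ I
    have h : -a.2 - -a.1 = -(a.2 - a.1) := by ring
    rw [h]; exact I.neg_mem ha
  mul_mem' := by
    intro a b ha hb
    have : a.2 * b.2 - a.1 * b.1 = (a.2 - a.1) * b.2 + a.1 * (b.2 - b.1) := by ring
    show a.2 * b.2 - a.1 * b.1 ∈ I
    rw [this]
    exact I.add_mem (I.mul_mem_right _ ha) (I.mul_mem_left _ hb)

/-- A commutative ring is quasi-Frobenius if it is Noetherian and self-injective. -/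
def IsQuasiFrobenius (R : Type*) [CommRing R] : Prop :=
  IsNoetherianRing R ∧ Module.Injective R R

namespace amalgDup

variable {R : Type*} [CommRing R] {I : Ideal R}

theorem mem_iff {p : R × R} : p ∈ amalgDup R I ↔ p.2 - p.1 ∈ I := Iff.rfl

theorem mul_one_sub_eq {a : R} (ha : a * a = a) (hI : I = Ideal.span {a})
    (s : amalgDup R I) : s.1.2 * (1 - a) = s.1.1 * (1 - a) := by
  obtain ⟨c, hc⟩ := Ideal.mem_span_singleton'.1 (hI.le (mem_iff.1 s.2))
  linear_combination -(1 - a) * hc - c * ha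

theorem isNoetherianRing_of_amalgDup (h : IsNoetherianRing (amalgDup R I)) :
    IsNoetherianRing R :=
  isNoetherianRing_of_surjective _ _ ((RingHom.fst R R).comp (amalgDup R I).subtype)
    fun r ↦ ⟨⟨(r, r), by simp [mem_iff]⟩, rfl⟩

/-- The map from `R` to `amalgDup R (a)` sending `1` to `(1, 1 - a)`. -/
def embed (a : R) (hI : I = Ideal.span {a}) (r : R) : amalgDup R I :=
  ⟨(r, r * (1 - a)), by
    rw [mem_iff, hI, Ideal.mem_span_singleton']
    exact ⟨-r, by ring⟩⟩

/-- The map from `R` to `amalgDup R (a)` sending `1` to `(0, a)`. -/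
def embedSnd (a : R) (hI : I = Ideal.span {a}) (r : R) : amalgDup R I :=
  ⟨(0, r * a), by
    rw [mem_iff, hI, Ideal.mem_span_singleton']
    exact ⟨r, by ring⟩⟩

theorem embed_add_embedSnd {a : R} (ha : a * a = a) (hI : I = Ideal.span {a})
    (s : amalgDup R I) : embed a hI s.1.1 + embedSnd a hI s.1.2 = s := by
  have h := mul_one_sub_eq ha hI s
  ext
  · simp [embed, embedSnd]
  · simp only [embed, embedSnd, Subring.coe_add, Prod.mk_add_mk]
    linear_combination -h

/-- For an idempotent `a`, the ring `amalgDup R (a)` is a quotient of `R × R`. -/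
theorem isNoetherianRing_of_idempotent [IsNoetherianRing R] {a : R} (ha : a * a = a)
    (hI : I = Ideal.span {a}) : IsNoetherianRing (amalgDup R I) := by
  let f : R × R →+* amalgDup R I :=
    { toFun p := embed a hI p.1 + embedSnd a hI p.2
      map_one' := by ext <;> simp [embed, embedSnd]
      map_zero' := by ext <;> simp [embed, embedSnd]
      map_add' p q := by
        ext
        · simp [embed, embedSnd]
        · simp only [embed, embedSnd, Subring.coe_add, Prod.mk_add_mk, Prod.fst_add, Prod.snd_add]
          ring
      map_mul' p q := by
        ext
        · simp [embed, embedSnd]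
        · simp only [embed, embedSnd, Subring.coe_add, Subring.coe_mul, Prod.mk_add_mk,
            Prod.mk_mul_mk, Prod.fst_mul, Prod.snd_mul]
          linear_combination (p.1 * q.2 + p.2 * q.1 - p.1 * q.1 - p.2 * q.2) * ha }
  exact isNoetherianRing_of_surjective _ _ f fun s ↦ ⟨s.1, embed_add_embedSnd ha hI s⟩

/-- If `amalgDup R I` is self-injective, then `I` is generated by an idempotent. -/
theorem exists_idempotent_of_baer (h : Module.Baer (amalgDup R I) (amalgDup R I)) :
    ∃ a : R, a * a = a ∧ I = Ideal.span {a} := by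
  let J : Ideal (amalgDup R I) := I.comap ((RingHom.fst R R).comp (amalgDup R I).subtype)
  have hJ (s : amalgDup R I) (hs : s ∈ J) : s.1.2 ∈ I := by
    have h1 : s.1.1 ∈ I := hs
    simpa using I.add_mem (mem_iff.1 s.2) h1
  let g : J →ₗ[amalgDup R I] amalgDup R I :=
    { toFun s := ⟨(0, s.1.1.2), by simpa [mem_iff] using hJ s.1 s.2⟩
      map_add' s t := by ext <;> simp
      map_smul' s t := by ext <;> simp }
  obtain ⟨f, hf⟩ := h J g
  have key (s : amalgDup R I) (hs : s ∈ J) : s.1 * (f 1).1 = (0, s.1.2) := by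
    have h1 : f s = g ⟨s, hs⟩ := hf s hs
    have h2 : f s = s * f 1 := by rw [← smul_eq_mul, ← map_smul, smul_eq_mul, mul_one]
    rw [h2] at h1
    exact congrArg Subtype.val h1
  have hx (u : R) (hu : u ∈ I) : u * (f 1).1.1 = 0 := by
    have := congrArg Prod.fst (key ⟨(u, 0), by simpa [mem_iff] using hu⟩ hu)
    simpa using this
  have hy (u : R) (hu : u ∈ I) : u * (f 1).1.2 = u := by
    have := congrArg Prod.snd (key ⟨(0, u), by simpa [mem_iff] using hu⟩ I.zero_mem)
    simpa using this
  have hmem := mem_iff.1 (f 1).2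
  have hmul (u : R) (hu : u ∈ I) : u * ((f 1).1.2 - (f 1).1.1) = u := by
    rw [mul_sub, hx u hu, hy u hu, sub_zero]
  refine ⟨_, hmul _ hmem, le_antisymm (fun u hu ↦ ?_) ?_⟩
  · exact Ideal.mem_span_singleton'.2 ⟨u, hmul u hu⟩
  · exact (Ideal.span_singleton_le_iff_mem _).2 hmem

theorem baer_of_amalgDup {a : R} (ha : a * a = a) (hI : I = Ideal.span {a})
    (h : Module.Baer (amalgDup R I) (amalgDup R I)) : Module.Baer R R := by
  intro J g
  let J' : Ideal (amalgDup R I) := J.comap ((RingHom.fst R R).comp (amalgDup R I).subtype)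
  let g' : J' →ₗ[amalgDup R I] amalgDup R I :=
    { toFun s := embed a hI (g ⟨s.1.1.1, s.2⟩)
      map_add' s t := by
        have h1 : g ⟨(s + t).1.1.1, (s + t).2⟩ = g ⟨s.1.1.1, s.2⟩ + g ⟨t.1.1.1, t.2⟩ := by
          rw [← map_add]; rfl
        rw [h1]
        ext <;> simp [embed, add_mul]
      map_smul' s t := by
        have h1 : g ⟨(s • t).1.1.1, (s • t).2⟩ = s.1.1 * g ⟨t.1.1.1, t.2⟩ := by
          rw [← smul_eq_mul, ← map_smul]; rfl
        rw [h1]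
        ext
        · simp [embed]
        · simp only [embed, RingHom.id_apply, smul_eq_mul, Subring.coe_mul, Prod.snd_mul]
          linear_combination -g ⟨t.1.1.1, t.2⟩ * mul_one_sub_eq ha hI s }
  obtain ⟨f, hf⟩ := h J' g'
  refine ⟨LinearMap.toSpanSingleton R R (f 1).1.1, fun x hx ↦ ?_⟩
  let s : amalgDup R I := ⟨(x, x), by simp [mem_iff]⟩
  have h1 : f s = g' ⟨s, hx⟩ := hf s hx
  have h2 : f s = s * f 1 := by rw [← smul_eq_mul, ← map_smul, smul_eq_mul, mul_one]
  rw [h2] at h1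
  exact congrArg (fun t ↦ t.1.1) h1

theorem baer_of_idempotent {a : R} (ha : a * a = a) (hI : I = Ideal.span {a})
    (h : Module.Baer R R) : Module.Baer (amalgDup R I) (amalgDup R I) := by
  have ext_mul (J : Ideal R) (g : J →ₗ[R] R) : ∃ c : R, ∀ x (hx : x ∈ J), g ⟨x, hx⟩ = x * c := by
    obtain ⟨f, hf⟩ := h J g
    exact ⟨f 1, fun x hx ↦ by rw [← hf x hx, ← smul_eq_mul, ← map_smul, smul_eq_mul, mul_one]⟩
  have embed_add (x y : R) : embed a hI (x + y) = embed a hI x + embed a hI y := by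
    ext <;> simp [embed, add_mul]
  have embedSnd_add (x y : R) : embedSnd a hI (x + y) = embedSnd a hI x + embedSnd a hI y := by
    ext <;> simp [embedSnd, add_mul]
  let diag (r : R) : amalgDup R I := ⟨(r, r), by simp [mem_iff]⟩
  have embed_mul (x y : R) : embed a hI (x * y) = diag x * embed a hI y := by
    ext <;> simp [embed, diag, mul_assoc]
  have embedSnd_mul (x y : R) : embedSnd a hI (x * y) = diag x * embedSnd a hI y := by
    ext <;> simp [embedSnd, diag, mul_assoc]
  intro J g
  let J₁ : Ideal R :=
    { carrier := {r | embed a hI r ∈ J}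
      add_mem' {x y} hx hy := by
        simp only [Set.mem_ofPred_eq] at *
        rw [embed_add]; exact J.add_mem hx hy
      zero_mem' := by
        have : embed a hI 0 = 0 := by ext <;> simp [embed]
        simp [this]
      smul_mem' c x hx := by
        simp only [Set.mem_ofPred_eq, smul_eq_mul] at *
        rw [embed_mul]; exact J.mul_mem_left _ hx }
  let J₂ : Ideal R :=
    { carrier := {r | embedSnd a hI r ∈ J}
      add_mem' {x y} hx hy := by
        simp only [Set.mem_ofPred_eq] at *
        rw [embedSnd_add]; exact J.add_mem hx hy
      zero_mem' := by
        have : embedSnd a hI 0 = 0 := by ext <;> simp [embedSnd]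
        simp [this]
      smul_mem' c x hx := by
        simp only [Set.mem_ofPred_eq, smul_eq_mul] at *
        rw [embedSnd_mul]; exact J.mul_mem_left _ hx }
  let g₁ : J₁ →ₗ[R] R :=
    { toFun r := (g ⟨embed a hI r.1, r.2⟩).1.1
      map_add' x y := by
        rw [← Prod.fst_add, ← Subring.coe_add, ← map_add]
        congr 4
        exact embed_add x.1 y.1
      map_smul' c x := by
        have : (⟨embed a hI (c • x).1, (c • x).2⟩ : J) = diag c • ⟨embed a hI x.1, x.2⟩ :=
          Subtype.ext (embed_mul c x.1)
        rw [this, map_smul]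
        rfl }
  let g₂ : J₂ →ₗ[R] R :=
    { toFun r := (g ⟨embedSnd a hI r.1, r.2⟩).1.2
      map_add' x y := by
        rw [← Prod.snd_add, ← Subring.coe_add, ← map_add]
        congr 4
        exact embedSnd_add x.1 y.1
      map_smul' c x := by
        have : (⟨embedSnd a hI (c • x).1, (c • x).2⟩ : J) = diag c • ⟨embedSnd a hI x.1, x.2⟩ :=
          Subtype.ext (embedSnd_mul c x.1)
        rw [this, map_smul]
        rfl }
  obtain ⟨c₁, hc₁⟩ := ext_mul J₁ g₁
  obtain ⟨c₂, hc₂⟩ := ext_mul J₂ g₂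
  refine ⟨LinearMap.toSpanSingleton _ _ (embed a hI c₁ + embedSnd a hI c₂), fun s hs ↦ ?_⟩
  have hp : embed a hI 1 * s = embed a hI s.1.1 := by
    ext
    · simp [embed]
    · simp only [embed, Subring.coe_mul, Prod.snd_mul]
      linear_combination mul_one_sub_eq ha hI s
  have hq : embedSnd a hI 1 * s = embedSnd a hI s.1.2 := by
    ext <;> simp [embedSnd, mul_comm]
  have hm₁ : embed a hI s.1.1 ∈ J := hp ▸ J.mul_mem_left _ hs
  have hm₂ : embedSnd a hI s.1.2 ∈ J := hq ▸ J.mul_mem_left _ hs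
  have e₁ : (g ⟨embed a hI s.1.1, hm₁⟩).1.1 = s.1.1 * c₁ := hc₁ s.1.1 hm₁
  have e₂ : (g ⟨embedSnd a hI s.1.2, hm₂⟩).1.2 = s.1.2 * c₂ := hc₂ s.1.2 hm₂
  have k₁ : g ⟨embed a hI s.1.1, hm₁⟩ = embed a hI 1 * g ⟨s, hs⟩ := by
    rw [← smul_eq_mul, ← map_smul]
    exact congrArg g (Subtype.ext hp.symm)
  have k₂ : g ⟨embedSnd a hI s.1.2, hm₂⟩ = embedSnd a hI 1 * g ⟨s, hs⟩ := by
    rw [← smul_eq_mul, ← map_smul]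
    exact congrArg g (Subtype.ext hq.symm)
  rw [k₁] at e₁
  rw [k₂] at e₂
  simp only [embed, embedSnd, Subring.coe_mul, Prod.fst_mul, Prod.snd_mul, one_mul] at e₁ e₂
  have h1 := mul_one_sub_eq ha hI s
  have h2 := mul_one_sub_eq ha hI (g ⟨s, hs⟩)
  ext
  · simp [embed, embedSnd, e₁]
  · simp only [LinearMap.toSpanSingleton_apply, smul_eq_mul, embed, embedSnd, Subring.coe_mul,
      Subring.coe_add, Prod.snd_mul, Prod.mk_add_mk]
    linear_combination c₁ * h1 - h2 - (1 - a) * e₁ - a * e₂ + (g ⟨s, hs⟩).1.2 * ha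

end amalgDup

theorem amalgDup_isQuasiFrobenius_iff (R : Type*) [CommRing R] (I : Ideal R)
    (hI : I ≠ ⊤) :
    IsQuasiFrobenius (amalgDup R I) ↔
      IsQuasiFrobenius R ∧ ∃ a : R, a * a = a ∧ I = Ideal.span {a} := by
  simp only [IsQuasiFrobenius, ← Module.Baer.iff_injective]
  constructor
  · rintro ⟨hN, hB⟩
    obtain ⟨a, ha, hIa⟩ := amalgDup.exists_idempotent_of_baer hB
    exact ⟨⟨amalgDup.isNoetherianRing_of_amalgDup hN, amalgDup.baer_of_amalgDup ha hIa hB⟩,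
      a, ha, hIa⟩
  · rintro ⟨⟨hN, hB⟩, a, ha, hIa⟩
    exact ⟨amalgDup.isNoetherianRing_of_idempotent ha hIa, amalgDup.baer_of_idempotent ha hIa hB⟩
end

section
/- Let R be a commutative ring and I a nonzero ideal of R. If the amalgamated duplication R⋈I is quasi-Frobenius, then R is quasi-Frobenius. -/
/-- If `amalgDup R I` is self-injective, then a linear map `f : J → R` on an ideal `J` of `R`, twisted
to `q ↦ (f q.1, c * f q.1)`, is given by multiplication by an element of `amalgDup R I`. -/
theorem amalgDup.exists_mul_eq_of_injective {R : Type*} [CommRing R] {I : Ideal R}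
    (h : Module.Injective (amalgDup R I) (amalgDup R I)) (J : Ideal R) (f : J →ₗ[R] R) (c : R)
    (hc : ∀ x, c * f x - f x ∈ I) (hcI : ∀ i ∈ I, ∀ x, i * (c * f x) = 0) :
    ∃ p ∈ amalgDup R I, ∀ q ∈ amalgDup R I, ∀ hq : q.1 ∈ J,
      q * p = (f ⟨q.1, hq⟩, c * f ⟨q.1, hq⟩) := by
  let π : amalgDup R I →+* R := (RingHom.fst R R).comp (amalgDup R I).subtype
  let F : J.comap π →ₗ[amalgDup R I] amalgDup R I :=
    { toFun := fun q => ⟨(f ⟨q.1.1.1, q.2⟩, c * f ⟨q.1.1.1, q.2⟩), hc _⟩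
      map_add' := by
        intro q q'
        have key : f ⟨(q + q').1.1.1, (q + q').2⟩ = f ⟨q.1.1.1, q.2⟩ + f ⟨q'.1.1.1, q'.2⟩ :=
          f.map_add ⟨q.1.1.1, q.2⟩ ⟨q'.1.1.1, q'.2⟩
        apply Subtype.ext
        apply Prod.ext
        · exact key
        · change c * f ⟨(q + q').1.1.1, (q + q').2⟩ = c * _ + c * _
          rw [key, mul_add]
      map_smul' := by
        intro a q
        have key : f ⟨(a • q).1.1.1, (a • q).2⟩ = a.1.1 * f ⟨q.1.1.1, q.2⟩ :=
          f.map_smul a.1.1 ⟨q.1.1.1, q.2⟩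
        apply Subtype.ext
        apply Prod.ext
        · exact key
        · change c * f ⟨(a • q).1.1.1, (a • q).2⟩ = a.1.2 * (c * _)
          rw [key]
          linear_combination -hcI _ a.2 ⟨q.1.1.1, q.2⟩ }
  obtain ⟨G, hG⟩ := Module.Baer.of_injective h _ F
  refine ⟨(G 1).1, (G 1).2, fun q hq hqJ => ?_⟩
  have h₁ : G ⟨q, hq⟩ = ⟨q, hq⟩ * G 1 := by
    rw [← smul_eq_mul, ← map_smul, smul_eq_mul, mul_one]
  have h₂ := hG ⟨q, hq⟩ hqJ
  rw [h₁] at h₂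
  exact congrArg Subtype.val h₂

/-- If `amalgDup R I` is self-injective, then `I` contains an identity element for itself. -/
theorem amalgDup.exists_mem_mul_eq_self {R : Type*} [CommRing R] {I : Ideal R}
    (h : Module.Injective (amalgDup R I) (amalgDup R I)) : ∃ e ∈ I, ∀ x ∈ I, x * e = x := by
  obtain ⟨p, hp, H⟩ := exists_mul_eq_of_injective h I I.subtype 0 (by simp) (by simp)
  refine ⟨p.1 - p.2, by simpa using I.neg_mem hp, fun x hx => ?_⟩
  have hxx := H (x, x) (show x - x ∈ I by simp) hx
  have h₁ : x * p.1 = x := congrArg Prod.fst hxx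
  have h₂ : x * p.2 = 0 * x := congrArg Prod.snd hxx
  linear_combination h₁ - h₂

theorem amalgDup.injective_of_injective {R : Type*} [CommRing R] {I : Ideal R}
    (h : Module.Injective (amalgDup R I) (amalgDup R I)) : Module.Injective R R := by
  obtain ⟨e, heI, he⟩ := exists_mem_mul_eq_self h
  refine Module.Baer.injective fun J f => ?_
  obtain ⟨p, -, H⟩ := exists_mul_eq_of_injective h J f (1 - e)
    (fun x => by
      have : (1 - e) * f x - f x = -f x * e := by ring
      rw [this]
      exact I.mul_mem_left _ heI)
    (fun i hi x => by linear_combination -f x * he i hi)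
  refine ⟨LinearMap.toSpanSingleton R R p.1, fun x hx => ?_⟩
  exact congrArg Prod.fst (H (x, x) (show x - x ∈ I by simp) hx)

theorem amalgDup.isNoetherianRing_of_isNoetherianRing {R : Type*} [CommRing R] {I : Ideal R}
    (h : IsNoetherianRing (amalgDup R I)) : IsNoetherianRing R :=
  isNoetherianRing_of_surjective _ _ ((RingHom.fst R R).comp (amalgDup R I).subtype)
    fun x => ⟨⟨(x, x), show x - x ∈ I by simp⟩, rfl⟩

theorem isQuasiFrobenius_of_amalgDup_isQuasiFrobenius (R : Type*) [CommRing R]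
    (I : Ideal R) (hI : I ≠ ⊥) (h : IsQuasiFrobenius (amalgDup R I)) :
    IsQuasiFrobenius R :=
  ⟨amalgDup.isNoetherianRing_of_isNoetherianRing h.1, amalgDup.injective_of_injective h.2⟩
end

section
/- Let R be a commutative local ring and I a nonzero ideal of R. If the amalgamated duplication R⋈I is quasi-Frobenius, then R is quasi-Frobenius and I = R. -/
/-- If `R ⋈ I` is self-injective, a linear map from an ideal of `R` into `I` is multiplication
by the first coordinate of an element of `R ⋈ I` whose second coordinate annihilates the
second coordinates of the elements of `R ⋈ I` lying over that ideal. -/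
theorem amalgDup_exists_mul_of_baer {R : Type*} [CommRing R] {I : Ideal R}
    (h : Module.Baer (amalgDup R I) (amalgDup R I)) (K : Ideal R) (f : K →ₗ[R] R)
    (hf : ∀ k, f k ∈ I) :
    ∃ a b : R, b - a ∈ I ∧ (∀ k : K, f k = k * a) ∧ ∀ k ∈ K, ∀ l, l - k ∈ I → l * b = 0 := by
  let π : amalgDup R I →+* R := (RingHom.fst R R).comp (amalgDup R I).subtype
  let g : K.comap π →ₗ[amalgDup R I] amalgDup R I :=
    { toFun := fun p => ⟨(f ⟨π p, p.2⟩, 0), by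
        show 0 - f ⟨π p, p.2⟩ ∈ I
        simpa using hf _⟩
      map_add' := fun p q => by
        refine Subtype.ext (Prod.ext ?_ (add_zero 0).symm)
        exact f.map_add ⟨π p, p.2⟩ ⟨π q, q.2⟩
      map_smul' := fun s p => by
        refine Subtype.ext (Prod.ext ?_ (mul_zero s.1.2).symm)
        exact f.map_smul (π s) ⟨π p, p.2⟩ }
  obtain ⟨G, hG⟩ := h _ g
  have key : ∀ (k l : R) (hk : k ∈ K), l - k ∈ I →
      f ⟨k, hk⟩ = k * (G 1).1.1 ∧ l * (G 1).1.2 = 0 := by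
    intro k l hk hl
    let p : amalgDup R I := ⟨(k, l), hl⟩
    have hp : p * G 1 = g ⟨p, hk⟩ := by
      rw [← hG p hk, ← smul_eq_mul, ← map_smul, smul_eq_mul, mul_one]
    exact ⟨(congrArg (fun s : amalgDup R I => s.1.1) hp).symm,
      congrArg (fun s : amalgDup R I => s.1.2) hp⟩
  exact ⟨(G 1).1.1, (G 1).1.2, (G 1).2, fun k => (key k k k.2 (by simp)).1,
    fun k hk l hl => (key k l hk hl).2⟩

/-- Over a local ring, a self-injective duplication along a nonzero ideal is along the
whole ring. -/
theorem amalgDup_eq_top_of_baer {R : Type*} [CommRing R] [IsLocalRing R] {I : Ideal R}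
    (hI : I ≠ ⊥) (h : Module.Baer (amalgDup R I) (amalgDup R I)) : I = ⊤ := by
  obtain ⟨a, b, hab, ha, hb⟩ := amalgDup_exists_mul_of_baer h I I.subtype fun k => k.2
  obtain ⟨i, hi, hi0⟩ := Submodule.exists_mem_ne_zero_of_ne_bot hI
  have hai : i = i * a := ha ⟨i, hi⟩
  have hbi : i * b = 0 := hb i hi i (by simp)
  have hb_nonunit : ¬IsUnit b := fun hu => hi0 (hu.mul_left_eq_zero.1 hbi)
  have ha_nonunit : ¬IsUnit (1 - a) := fun hu =>
    hi0 (hu.mul_left_eq_zero.1 (by rw [mul_sub, mul_one, ← hai, sub_self]))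
  have hunit : IsUnit (b - a) := by
    by_contra hu
    refine IsLocalRing.nonunits_add ha_nonunit hb_nonunit ?_
    rcases IsLocalRing.isUnit_or_isUnit_of_add_one (a := 1 - a + b) (b := a - b) (by ring)
      with h' | h'
    · exact h'
    · exact absurd (by simpa using h'.neg) hu
  exact Ideal.eq_top_of_isUnit_mem I hab hunit

theorem amalgDup_isQuasiFrobenius_local (R : Type*) [CommRing R] [IsLocalRing R]
    (I : Ideal R) (hI : I ≠ ⊥) (h : IsQuasiFrobenius (amalgDup R I)) :
    IsQuasiFrobenius R ∧ I = ⊤ := by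
  have hB : Module.Baer (amalgDup R I) (amalgDup R I) := Module.Baer.of_injective h.2
  have hT : I = ⊤ := amalgDup_eq_top_of_baer hI hB
  have := h.1
  refine ⟨⟨?_, Module.Baer.injective fun K f => ?_⟩, hT⟩
  · refine isNoetherianRing_of_surjective (amalgDup R I) R
      ((RingHom.fst R R).comp (amalgDup R I).subtype) fun r => ⟨⟨(r, r), ?_⟩, rfl⟩
    show r - r ∈ I
    simp
  · obtain ⟨a, -, -, ha, -⟩ := amalgDup_exists_mul_of_baer hB K f fun _ => by simp [hT]
    exact ⟨LinearMap.toSpanSingleton R R a, fun x hx => (ha ⟨x, hx⟩).symm⟩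
end

section
/- If R is a commutative local ring and I is a nonzero proper ideal of R, then the amalgamated duplication R⋈I is not quasi-Frobenius. -/
/-- The ideal `I × I` of `amalgDup R I`. -/
def amalgDupProdIdeal (R : Type*) [CommRing R] (I : Ideal R) : Ideal (amalgDup R I) :=
  (I.prod I).comap (amalgDup R I).subtype

/-- The projection `(a, b) ↦ (0, b)` from the ideal `I × I` to `amalgDup R I`. -/
def amalgDupSnd (R : Type*) [CommRing R] (I : Ideal R) :
    amalgDupProdIdeal R I →ₗ[amalgDup R I] amalgDup R I where
  toFun p := ⟨(0, p.1.1.2), by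
    have h : p.1.1.2 ∈ I := p.2.2
    change p.1.1.2 - 0 ∈ I
    rwa [sub_zero]⟩
  map_add' p q := by
    apply Subtype.ext
    apply Prod.ext <;> simp
  map_smul' r p := by
    apply Subtype.ext
    apply Prod.ext <;> simp

/-- Self-injectivity of `amalgDup R I` provides an element acting on `I × I` as `(0, 1)`. -/
theorem exists_annihilator_of_injective_amalgDup {R : Type*} [CommRing R] {I : Ideal R}
    (h : Module.Injective (amalgDup R I) (amalgDup R I)) :
    ∃ x y : R, y - x ∈ I ∧ ∀ a ∈ I, a * x = 0 ∧ a * y = a := by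
  obtain ⟨f, hf⟩ := Module.Baer.of_injective h (amalgDupProdIdeal R I) (amalgDupSnd R I)
  refine ⟨(f 1).1.1, (f 1).1.2, (f 1).2, fun a ha => ?_⟩
  let p : amalgDup R I := ⟨(a, a), by change a - a ∈ I; simp⟩
  have hmem : p ∈ amalgDupProdIdeal R I := ⟨ha, ha⟩
  have hp : p * f 1 = amalgDupSnd R I ⟨p, hmem⟩ := by
    rw [← hf p hmem, ← smul_eq_mul, ← map_smul, smul_eq_mul, mul_one]
  have hp' := congrArg Subtype.val hp
  exact ⟨congrArg Prod.fst hp', congrArg Prod.snd hp'⟩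

theorem amalgDup_not_isQuasiFrobenius_local (R : Type*) [CommRing R] [IsLocalRing R]
    (I : Ideal R) (hbot : I ≠ ⊥) (htop : I ≠ ⊤) :
    ¬ IsQuasiFrobenius (amalgDup R I) := by
  rintro ⟨-, h⟩
  obtain ⟨x, y, hxy, hann⟩ := exists_annihilator_of_injective_amalgDup h
  refine hbot ((Submodule.eq_bot_iff I).mpr fun a ha => ?_)
  obtain ⟨hx, hy⟩ := hann a ha
  by_cases hu : IsUnit x
  · exact hu.mul_left_eq_zero.mp hx
  · have hym : y ∈ IsLocalRing.maximalIdeal R := by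
      have hadd := Ideal.add_mem _ (IsLocalRing.le_maximalIdeal htop hxy)
        ((IsLocalRing.mem_maximalIdeal x).mpr hu)
      rwa [sub_add_cancel] at hadd
    have hunit : IsUnit (1 - y) := IsLocalRing.isUnit_one_sub_self_of_mem_nonunits y hym
    exact hunit.mul_left_eq_zero.mp (by rw [mul_sub, mul_one, hy, sub_self])
end

section
/- Let R be a commutative ring and I, J two ideals of R with I ∩ J = {0} and I + J = R. Then there is a ring isomorphism R⋈I ≅ (R/I) × (R/J) × (R/J). -/
/-- The ring homomorphism `(x, y) ↦ (x mod I, x mod J, y mod J)` on `R ⋈ I`. -/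
def amalgDupToProd (R : Type*) [CommRing R] (I J : Ideal R) :
    amalgDup R I →+* (R ⧸ I) × (R ⧸ J) × (R ⧸ J) :=
  let fst := (RingHom.fst R R).comp (amalgDup R I).subtype
  let snd := (RingHom.snd R R).comp (amalgDup R I).subtype
  ((Ideal.Quotient.mk I).comp fst).prod
    (((Ideal.Quotient.mk J).comp fst).prod ((Ideal.Quotient.mk J).comp snd))

theorem amalgDupToProd_injective {R : Type*} [CommRing R] {I J : Ideal R}
    (hmeet : I ⊓ J = ⊥) : Function.Injective (amalgDupToProd R I J) := by
  rw [injective_iff_map_eq_zero]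
  rintro ⟨⟨x, y⟩, hxy⟩ h
  have hxy' : y - x ∈ I := hxy
  obtain ⟨hxI, hxJ, hyJ⟩ : Ideal.Quotient.mk I x = 0 ∧ Ideal.Quotient.mk J x = 0 ∧
      Ideal.Quotient.mk J y = 0 := by
    simpa [amalgDupToProd, Prod.ext_iff] using h
  rw [Ideal.Quotient.eq_zero_iff_mem] at hxI hxJ hyJ
  have hyI : y ∈ I := by simpa using I.add_mem hxy' hxI
  have hx : x ∈ I ⊓ J := ⟨hxI, hxJ⟩
  have hy : y ∈ I ⊓ J := ⟨hyI, hyJ⟩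
  rw [hmeet, Ideal.mem_bot] at hx hy
  exact Subtype.ext (Prod.ext hx hy)

theorem amalgDupToProd_surjective {R : Type*} [CommRing R] {I J : Ideal R}
    (hjoin : I + J = ⊤) : Function.Surjective (amalgDupToProd R I J) := by
  rintro ⟨a, b, c⟩
  obtain ⟨a, rfl⟩ := Ideal.Quotient.mk_surjective a
  obtain ⟨b, rfl⟩ := Ideal.Quotient.mk_surjective b
  obtain ⟨c, rfl⟩ := Ideal.Quotient.mk_surjective c
  obtain ⟨e, he, f, hf, hef⟩ := Submodule.mem_sup.mp ((Ideal.eq_top_iff_one _).mp hjoin)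
  have hmem : (a * f + c * e) - (a * f + b * e) ∈ I := by
    rw [show (a * f + c * e) - (a * f + b * e) = (c - b) * e by ring]
    exact I.mul_mem_left _ he
  have hI : Ideal.Quotient.mk I (a * f + b * e) = Ideal.Quotient.mk I a := by
    rw [Ideal.Quotient.eq,
      show a * f + b * e - a = (b - a) * e by linear_combination a * hef]
    exact I.mul_mem_left _ he
  have hJ (d : R) : Ideal.Quotient.mk J (a * f + d * e) = Ideal.Quotient.mk J d := by
    rw [Ideal.Quotient.eq,
      show a * f + d * e - d = (a - d) * f by linear_combination d * hef]
    exact J.mul_mem_left _ hf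
  exact ⟨⟨(a * f + b * e, a * f + c * e), hmem⟩, Prod.ext hI (Prod.ext (hJ b) (hJ c))⟩

theorem amalgDup_equiv_of_comaximal (R : Type*) [CommRing R] (I J : Ideal R)
    (hmeet : I ⊓ J = ⊥) (hjoin : I + J = ⊤) :
    Nonempty (amalgDup R I ≃+* (R ⧸ I) × (R ⧸ J) × (R ⧸ J)) :=
  ⟨RingEquiv.ofBijective (amalgDupToProd R I J)
    ⟨amalgDupToProd_injective hmeet, amalgDupToProd_surjective hjoin⟩⟩
end

section
/- Let R be a commutative ring and e an idempotent element of R. Then the ideals I = eR and J = (1-e)R satisfy I + J = R and I ∩ J = {0}; consequently there is a ring isomorphism R⋈(eR) ≅ (R/(e)) × (R/(1-e)) × (R/(1-e)). -/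
/-- The ring homomorphism `(x, y) ↦ (x mod I, x mod J, y mod J)` on the amalgamated duplication. -/
def amalgDupToQuotients {R : Type*} [CommRing R] (I J : Ideal R) :
    amalgDup R I →+* (R ⧸ I) × (R ⧸ J) × (R ⧸ J) :=
  let fst := (RingHom.fst R R).comp (amalgDup R I).subtype
  let snd := (RingHom.snd R R).comp (amalgDup R I).subtype
  ((Ideal.Quotient.mk I).comp fst).prod
    (((Ideal.Quotient.mk J).comp fst).prod ((Ideal.Quotient.mk J).comp snd))

theorem amalgDupToQuotients_apply {R : Type*} [CommRing R] (I J : Ideal R) (p : amalgDup R I) :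
    amalgDupToQuotients I J p = (Ideal.Quotient.mk I p.1.1, Ideal.Quotient.mk J p.1.1,
      Ideal.Quotient.mk J p.1.2) := rfl

theorem amalgDupToQuotients_injective {R : Type*} [CommRing R] {I J : Ideal R}
    (h : I ⊓ J = ⊥) : Function.Injective (amalgDupToQuotients I J) := by
  rw [injective_iff_map_eq_zero]
  rintro ⟨⟨x, y⟩, hxy⟩ h0
  have eq_zero : ∀ z ∈ I, z ∈ J → z = 0 := fun z hI hJ => by
    have hz : z ∈ I ⊓ J := ⟨hI, hJ⟩
    rwa [h, Ideal.mem_bot] at hz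
  simp only [amalgDupToQuotients_apply, Prod.mk_eq_zero, Ideal.Quotient.eq_zero_iff_mem] at h0
  obtain ⟨hxI, hxJ, hyJ⟩ := h0
  have hyI : y ∈ I := (Submodule.sub_mem_iff_left I hxI).mp hxy
  ext
  · exact eq_zero x hxI hxJ
  · exact eq_zero y hyI hyJ

theorem amalgDupToQuotients_surjective {R : Type*} [CommRing R] {I J : Ideal R}
    (h : I + J = ⊤) : Function.Surjective (amalgDupToQuotients I J) := by
  rintro ⟨a, b, c⟩
  obtain ⟨a, rfl⟩ := Ideal.Quotient.mk_surjective a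
  obtain ⟨b, rfl⟩ := Ideal.Quotient.mk_surjective b
  obtain ⟨c, rfl⟩ := Ideal.Quotient.mk_surjective c
  obtain ⟨i, hi, j, hj, hij⟩ := Submodule.mem_sup.mp ((Ideal.eq_top_iff_one _).mp h)
  obtain rfl : j = 1 - i := eq_sub_of_add_eq' hij
  have hmem : (a * (1 - i) + c * i) - (a * (1 - i) + b * i) ∈ I := by
    rw [add_sub_add_left_eq_sub, ← sub_mul]
    exact I.mul_mem_left _ hi
  refine ⟨⟨(a * (1 - i) + b * i, a * (1 - i) + c * i), hmem⟩, ?_⟩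
  simp only [amalgDupToQuotients_apply, Prod.mk.injEq, Ideal.Quotient.eq]
  refine ⟨?_, ?_, ?_⟩
  · convert I.mul_mem_left (b - a) hi using 1
    ring
  · convert J.mul_mem_left (a - b) hj using 1
    ring
  · convert J.mul_mem_left (a - c) hj using 1
    ring

theorem amalgDup_span_idempotent (R : Type*) [CommRing R] (e : R) (he : e * e = e) :
    Ideal.span {e} + Ideal.span {1 - e} = ⊤ ∧
    Ideal.span {e} ⊓ Ideal.span {1 - e} = ⊥ ∧
    Nonempty (amalgDup R (Ideal.span {e}) ≃+*
      (R ⧸ Ideal.span {e}) × (R ⧸ Ideal.span {1 - e}) × (R ⧸ Ideal.span {1 - e})) := by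
  have hsup : Ideal.span {e} + Ideal.span {1 - e} = ⊤ :=
    (Ideal.eq_top_iff_one _).mpr <| Submodule.mem_sup.mpr
      ⟨e, Ideal.mem_span_singleton_self e, 1 - e, Ideal.mem_span_singleton_self _,
        add_sub_cancel e 1⟩
  have hinf : Ideal.span {e} ⊓ Ideal.span {1 - e} = ⊥ := by
    refine (Submodule.eq_bot_iff _).mpr ?_
    rintro x ⟨hx, hx'⟩
    obtain ⟨a, rfl⟩ := Ideal.mem_span_singleton'.mp hx
    obtain ⟨b, hb⟩ := Ideal.mem_span_singleton'.mp hx'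
    linear_combination (-a - b) * he - e * hb
  exact ⟨hsup, hinf, ⟨RingEquiv.ofBijective (amalgDupToQuotients _ _)
    ⟨amalgDupToQuotients_injective hinf, amalgDupToQuotients_surjective hsup⟩⟩⟩
end

section
/- Let R be a commutative ring and I an ideal of R. If every ideal 𝒥 of the amalgamated duplication R⋈I satisfies Ann_{R⋈I}(Ann_{R⋈I}(𝒥)) = 𝒥, then every ideal J of R satisfies Ann_R(Ann_R(J)) = J. -/
namespace amalgDup

variable {R : Type*} [CommRing R] {I : Ideal R}

/-- The first projection `R ⋈ I → R`. -/
def fstHom (I : Ideal R) : amalgDup R I →+* R :=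
  (RingHom.fst R R).comp (amalgDup R I).subtype

/-- The diagonal element `(r, r)` of `R ⋈ I`. -/
def diag (I : Ideal R) (r : R) : amalgDup R I :=
  ⟨(r, r), show r - r ∈ I by simp⟩

lemma mul_eq_zero_iff {p q : amalgDup R I} :
    p * q = 0 ↔ p.1.1 * q.1.1 = 0 ∧ p.1.2 * q.1.2 = 0 := by
  rw [Subtype.ext_iff, Prod.ext_iff]
  rfl

lemma mul_eq_zero_of_mem_annihilator_comap {J : Ideal R} {p : amalgDup R I}
    (hp : p ∈ (J.comap (fstHom I)).annihilator) {j : R} (hj : j ∈ J) :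
    p.1.1 * j = 0 ∧ p.1.2 * j = 0 :=
  mul_eq_zero_iff.1 (Submodule.mem_annihilator.1 hp (diag I j) hj)

lemma snd_mem_annihilator_of_mem_annihilator_comap {J : Ideal R} {p : amalgDup R I}
    (hp : p ∈ (J.comap (fstHom I)).annihilator) : p.1.2 ∈ I.annihilator := by
  refine Submodule.mem_annihilator.2 fun i hi => ?_
  let q : amalgDup R I := ⟨(0, i), show i - 0 ∈ I by simpa using hi⟩
  exact (mul_eq_zero_iff.1 (Submodule.mem_annihilator.1 hp q J.zero_mem)).2

lemma eq_zero_of_mul_sup_annihilator_eq_zero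
    (h : ∀ 𝒥 : Ideal (amalgDup R I), 𝒥.annihilator.annihilator = 𝒥) {a : R}
    (ha : ∀ x ∈ I ⊔ I.annihilator, a * x = 0) : a = 0 := by
  have hmem : diag I a ∈ (Ideal.comap (fstHom I) ⊥).annihilator.annihilator := by
    refine Submodule.mem_annihilator.2 fun p hp => ?_
    have hp₂ := snd_mem_annihilator_of_mem_annihilator_comap hp
    have hp₁ : p.1.1 ∈ I ⊔ I.annihilator := by
      have hsub := sub_mem (Ideal.mem_sup_right (S := I) hp₂)
        (Ideal.mem_sup_left (T := I.annihilator) (show p.1.2 - p.1.1 ∈ I from p.2))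
      simpa using hsub
    exact mul_eq_zero_iff.2 ⟨ha _ hp₁, ha _ (Ideal.mem_sup_right hp₂)⟩
  rw [h] at hmem
  exact hmem

lemma sup_annihilator_eq_top
    (h : ∀ 𝒥 : Ideal (amalgDup R I), 𝒥.annihilator.annihilator = 𝒥) :
    I ⊔ I.annihilator = ⊤ := by
  have hmem : (1 : amalgDup R I) ∈
      ((I ⊔ I.annihilator).comap (fstHom I)).annihilator.annihilator := by
    refine Submodule.mem_annihilator.2 fun p hp => mul_eq_zero_iff.2 ?_
    have h₁ := eq_zero_of_mul_sup_annihilator_eq_zero h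
      fun x hx => (mul_eq_zero_of_mem_annihilator_comap hp hx).1
    have h₂ := eq_zero_of_mul_sup_annihilator_eq_zero h
      fun x hx => (mul_eq_zero_of_mem_annihilator_comap hp hx).2
    simp [h₁, h₂]
  rw [h] at hmem
  exact (Ideal.eq_top_iff_one _).2 hmem

end amalgDup

open amalgDup in
theorem double_annihilator_descends (R : Type*) [CommRing R] (I : Ideal R)
    (h : ∀ 𝒥 : Ideal (amalgDup R I), 𝒥.annihilator.annihilator = 𝒥) :
    ∀ J : Ideal R, J.annihilator.annihilator = J := by
  intro J
  refine le_antisymm (fun r hr => ?_) fun j hj => Submodule.mem_annihilator.2 fun a ha => by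
    simpa [mul_comm] using Submodule.mem_annihilator.1 ha j hj
  obtain ⟨i, hi, k, hk, hik⟩ := Submodule.mem_sup.1
    ((Ideal.eq_top_iff_one _).1 (sup_annihilator_eq_top h))
  have hkI : ∀ x ∈ I, k * x = 0 := Submodule.mem_annihilator.1 hk
  let q : amalgDup R I := ⟨(r, r * k), show r * k - r ∈ I by
    have hrk : r * k - r = -r * i := by linear_combination r * hik
    exact hrk ▸ I.mul_mem_left _ hi⟩
  have hq : q ∈ (J.comap (fstHom I)).annihilator.annihilator := by
    refine Submodule.mem_annihilator.2 fun p hp => mul_eq_zero_iff.2 ?_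
    have hrp : r * p.1.1 = 0 := Submodule.mem_annihilator.1 hr _
      (Submodule.mem_annihilator.2 fun j hj => (mul_eq_zero_of_mem_annihilator_comap hp hj).1)
    have hkp : k * (p.1.2 - p.1.1) = 0 := hkI _ p.2
    exact ⟨hrp, show r * k * p.1.2 = 0 by linear_combination r * hkp + k * hrp⟩
  rw [h] at hq
  exact hq
end

section
/- Let R be a commutative quasi-Frobenius ring and a an idempotent element of R with Ra a proper ideal. Then the amalgamated duplication R⋈(Ra) is quasi-Frobenius. -/
section

variable {R : Type*} [CommRing R] {a : R}

theorem mem_amalgDup_span_singleton_iff (ha : a * a = a) {p : R × R} :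
    p ∈ amalgDup R (Ideal.span {a}) ↔ (1 - a) * p.2 = (1 - a) * p.1 := by
  change p.2 - p.1 ∈ Ideal.span {a} ↔ _
  rw [Ideal.mem_span_singleton']
  constructor
  · rintro ⟨c, hc⟩
    linear_combination (-(1 - a)) * hc - c * ha
  · intro h
    exact ⟨p.2 - p.1, by linear_combination -h⟩

/-- The retraction `(x, y) ↦ (x, (1 - a) x + a y)` of `R × R` onto the amalgamated duplication
of `R` along the ideal generated by an idempotent `a`. -/
def amalgDupRetraction (ha : a * a = a) : R × R →+* amalgDup R (Ideal.span {a}) where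
  toFun p := ⟨(p.1, (1 - a) * p.1 + a * p.2), (mem_amalgDup_span_singleton_iff ha).2 (by
    linear_combination (p.1 - p.2) * ha)⟩
  map_one' := Subtype.ext (Prod.ext rfl (by simp))
  map_zero' := Subtype.ext (Prod.ext rfl (by simp))
  map_add' p q := Subtype.ext (Prod.ext rfl (by simp; ring))
  map_mul' p q := Subtype.ext (Prod.ext rfl (by
    simp only [Prod.fst_mul, Prod.snd_mul, Subring.coe_mul]
    linear_combination (-(p.1 - p.2) * (q.1 - q.2)) * ha))

theorem amalgDupRetraction_coe (ha : a * a = a) (s : amalgDup R (Ideal.span {a})) :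
    amalgDupRetraction ha (s : R × R) = s :=
  Subtype.ext (Prod.ext rfl (by
    have := (mem_amalgDup_span_singleton_iff ha).1 s.2
    simp only [amalgDupRetraction, RingHom.coe_mk, MonoidHom.coe_mk, OneHom.coe_mk]
    linear_combination -this))

theorem isNoetherianRing_amalgDup_of_idempotent [IsNoetherianRing R] (ha : a * a = a) :
    IsNoetherianRing (amalgDup R (Ideal.span {a})) :=
  isNoetherianRing_of_surjective _ _ (amalgDupRetraction ha)
    fun s => ⟨s, amalgDupRetraction_coe ha s⟩

/-- An `R`-linear map from an ideal `J` of a commutative `R`-algebra `S` to a self-injective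
ring `R`, restricted to the multiples of a fixed element `e`, is given by a multiplication. -/
theorem Module.Baer.exists_mul_eq_of_smul {S : Type*} [CommRing S] [Algebra R S]
    (hR : Module.Baer R R) (J : Ideal S) (e : S) (g : J →ₗ[R] R) :
    ∃ t : R, ∀ (r : R) (hr : r • e ∈ J), g ⟨r • e, hr⟩ = t * r := by
  let φ : R →ₗ[R] S := LinearMap.toSpanSingleton R S e
  let K : Ideal R := (J.restrictScalars R).comap φ
  let ψ : K →ₗ[R] J := (φ.domRestrict K).codRestrict (J.restrictScalars R) fun r => r.2
  obtain ⟨k, hk⟩ := hR K (g ∘ₗ ψ)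
  refine ⟨k 1, fun r hr => ?_⟩
  have h : k r = k 1 * r := by
    rw [mul_comm, ← smul_eq_mul, ← map_smul, smul_eq_mul, mul_one]
  exact (hk r hr).symm.trans h

/-- The amalgamated duplication as an algebra over `R` along the diagonal embedding. -/
abbrev amalgDupAlgebra (I : Ideal R) : Algebra R (amalgDup R I) :=
  (((algebraMap R (R × R)).codRestrict (amalgDup R I)) fun r => by
    change r - r ∈ I
    simp).toAlgebra

theorem baer_amalgDup_of_idempotent (hR : Module.Baer R R) (ha : a * a = a) :
    Module.Baer (amalgDup R (Ideal.span {a})) (amalgDup R (Ideal.span {a})) := by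
  intro J f
  let := amalgDupAlgebra (Ideal.span {a})
  let S := amalgDup R (Ideal.span {a})
  let ρ := amalgDupRetraction ha
  have coe_smul (r : R) (s : S) : ((r • s : S) : R × R) = (r * s.1.1, r * s.1.2) := by
    rw [Algebra.smul_def]; rfl
  have hS (s : S) := (mem_amalgDup_span_singleton_iff ha).1 s.2
  let p₁ : S →ₗ[R] R :=
    { toFun s := s.1.1, map_add' _ _ := rfl, map_smul' r s := by rw [coe_smul]; rfl }
  let p₂ : S →ₗ[R] R :=
    { toFun s := s.1.2, map_add' _ _ := rfl, map_smul' r s := by rw [coe_smul]; rfl }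
  let fR : J →ₗ[R] S :=
    { toFun := f
      map_add' := map_add f
      map_smul' r j := by
        have : r • j = (algebraMap R S r) • j := Subtype.ext (Algebra.smul_def _ _)
        rw [this, map_smul]
        exact (Algebra.smul_def r (f j)).symm }
  let e₁ : S := ρ (1, 0)
  let e₂ : S := ρ (0, 1)
  obtain ⟨t₁, h₁⟩ := hR.exists_mul_eq_of_smul J e₁ (p₁ ∘ₗ fR)
  obtain ⟨t₂, h₂⟩ := hR.exists_mul_eq_of_smul J e₂ (p₂ ∘ₗ fR)
  refine ⟨LinearMap.toSpanSingleton S S (ρ (t₁, t₂)), fun j hj => ?_⟩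
  have hj₁ : j.1.1 • e₁ = e₁ * j := Subtype.ext (by
    rw [coe_smul]
    refine Prod.ext (mul_comm _ _) ?_
    simp only [e₁, ρ, amalgDupRetraction, RingHom.coe_mk, MonoidHom.coe_mk, OneHom.coe_mk,
      Subring.coe_mul, Prod.snd_mul]
    linear_combination -hS j)
  have hj₂ : j.1.2 • e₂ = e₂ * j := Subtype.ext (by
    rw [coe_smul]
    refine Prod.ext ?_ (mul_comm _ _)
    simp [e₂, ρ, amalgDupRetraction])
  have hf₁ := h₁ j.1.1 (hj₁ ▸ J.mul_mem_left _ hj)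
  have hf₂ := h₂ j.1.2 (hj₂ ▸ J.mul_mem_left _ hj)
  have key (e : S) (r : R) (hr : r • e = e * j) (h : r • e ∈ J) :
      fR ⟨r • e, h⟩ = e * f ⟨j, hj⟩ := by
    rw [← smul_eq_mul, ← map_smul]
    exact congrArg f (Subtype.ext hr)
  rw [LinearMap.comp_apply, key _ _ hj₁] at hf₁
  rw [LinearMap.comp_apply, key _ _ hj₂] at hf₂
  have hf := hS (f ⟨j, hj⟩)
  simp only [e₁, e₂, ρ, p₁, p₂, amalgDupRetraction, LinearMap.coe_mk, AddHom.coe_mk,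
    RingHom.coe_mk, MonoidHom.coe_mk, OneHom.coe_mk, Subring.coe_mul, Prod.fst_mul,
    Prod.snd_mul] at hf₁ hf₂
  rw [LinearMap.toSpanSingleton_apply, smul_eq_mul]
  refine Subtype.ext (Prod.ext ?_ ?_)
  · simp only [ρ, amalgDupRetraction, RingHom.coe_mk, MonoidHom.coe_mk, OneHom.coe_mk,
      Subring.coe_mul, Prod.fst_mul]
    linear_combination -hf₁
  · simp only [ρ, amalgDupRetraction, RingHom.coe_mk, MonoidHom.coe_mk, OneHom.coe_mk,
      Subring.coe_mul, Prod.snd_mul]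
    linear_combination (-(1 - a)) * hf₁ - a * hf₂ - hf + t₁ * hS j + (f ⟨j, hj⟩).1.2 * ha

end

theorem amalgDup_isQuasiFrobenius_of_idempotent (R : Type*) [CommRing R]
    (hR : IsQuasiFrobenius R) (a : R) (ha : a * a = a)
    (hproper : Ideal.span {a} ≠ (⊤ : Ideal R)) :
    IsQuasiFrobenius (amalgDup R (Ideal.span {a})) := by
  obtain ⟨_, hinj⟩ := hR
  exact ⟨isNoetherianRing_amalgDup_of_idempotent ha,
    (baer_amalgDup_of_idempotent (Module.Baer.of_injective hinj) ha).injective⟩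
end
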